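/- Let M₁, M₂ ∈ ℝ^{d×d} be nonzero matrices. If for all vectors x, y ∈ ℝ^d, xᵀM₁y > 0 implies xᵀM₂y > 0, then M₁ = λM₂ for some scalar λ > 0. -/

import Mathlib

open Matrix

lemma aux_functional {V : Type*} [AddCommGroup V] [Module ℝ V] (f g : V →ₗ[ℝ] ℝ)
    (h : ∀ x, 0 < f x → 0 < g x) (x0 : V) (h0 : f x0 ≠ 0) (x : V) :
    g x * f x0 = g x0 * f x := by
  have key : ∀ w : V, 0 < f w → g x * f w = g w * f x := by
    intro w hw
    have hz : ∀ t : ℝ, 0 < g w + t * (f w * g x - f x * g w) := by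
      intro t
      have := h (w + t • (f w • x - f x • w)) (by
        simp only [map_add, map_sub, map_smul, smul_eq_mul]
        have : f w * f x - f x * f w = 0 := by ring
        rw [this]; simpa using hw)
      simpa only [map_add, map_sub, map_smul, smul_eq_mul] using this
    by_contra hne
    have hs : f w * g x - f x * g w ≠ 0 := fun e => hne (by linarith)
    have := hz (-(g w) / (f w * g x - f x * g w))
    rw [div_mul_cancel₀ _ hs] at this
    linarith
  rcases lt_or_gt_of_ne h0 with hn | hp
  · have := key (-x0) (by simpa using hn)
    simp only [map_neg] at this
    linarith
  · exact key x0 hp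

/-- If the bilinear form of M₁ being positive always implies that of M₂ is positive,
then M₁ is a positive scalar multiple of M₂. -/
theorem eq_smul_of_bilinear_pos_imp {d : ℕ} (M₁ M₂ : Matrix (Fin d) (Fin d) ℝ)
    (h₁ : M₁ ≠ 0) (h₂ : M₂ ≠ 0)
    (h : ∀ x y : Fin d → ℝ, 0 < x ⬝ᵥ M₁.mulVec y → 0 < x ⬝ᵥ M₂.mulVec y) :
    ∃ l : ℝ, 0 < l ∧ M₁ = l • M₂ := by
  have hB : ∀ (M : Matrix (Fin d) (Fin d) ℝ) (x y : Fin d → ℝ),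
      Matrix.toLinearMap₂' ℝ M x y = x ⬝ᵥ M.mulVec y := fun M x y =>
    Matrix.toLinearMap₂'_apply' M x y
  obtain ⟨B₁, e₁⟩ : ∃ B : (Fin d → ℝ) →ₗ[ℝ] (Fin d → ℝ) →ₗ[ℝ] ℝ, B = Matrix.toLinearMap₂' ℝ M₁ := ⟨_, rfl⟩
  obtain ⟨B₂, e₂⟩ : ∃ B : (Fin d → ℝ) →ₗ[ℝ] (Fin d → ℝ) →ₗ[ℝ] ℝ, B = Matrix.toLinearMap₂' ℝ M₂ := ⟨_, rfl⟩
  have hh : ∀ x y, 0 < B₁ x y → 0 < B₂ x y := by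
    intro x y
    rw [e₁, e₂, hB, hB]
    exact h x y
  have hne : B₁ ≠ 0 := by
    rw [e₁]; simpa using h₁
  obtain ⟨x0, y0, hp⟩ : ∃ x y, 0 < B₁ x y := by
    by_contra! hc
    apply hne
    refine LinearMap.ext fun x => LinearMap.ext fun y => le_antisymm (hc x y) ?_
    have := hc (-x) y
    simpa using this
  have hq := hh _ _ hp
  have row : ∀ x, B₁ x y0 ≠ 0 → ∀ y, B₂ x y * B₁ x y0 = B₂ x y0 * B₁ x y := fun x hx y =>
    aux_functional (B₁ x) (B₂ x) (hh x) y0 hx y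
  have col : ∀ x, B₂ x y0 * B₁ x0 y0 = B₂ x0 y0 * B₁ x y0 := fun x =>
    aux_functional (B₁.flip y0) (B₂.flip y0) (fun x => hh x y0) x0 hp.ne' x
  have good : ∀ x, B₁ x y0 ≠ 0 → ∀ y, B₂ x y * B₁ x0 y0 = B₂ x0 y0 * B₁ x y := by
    intro x hx y
    apply mul_right_cancel₀ hx
    linear_combination B₁ x0 y0 * row x hx y + B₁ x y * col x
  have all : ∀ x y, B₂ x y * B₁ x0 y0 = B₂ x0 y0 * B₁ x y := by
    intro x y
    by_cases hx : B₁ x y0 = 0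
    · have h1 := good (x + x0) (by simpa [hx] using hp.ne') y
      have h2 := good x0 hp.ne' y
      simp only [map_add, LinearMap.add_apply] at h1
      linarith
    · exact good x hx y
  refine ⟨B₁ x0 y0 / B₂ x0 y0, div_pos hp hq, ?_⟩
  apply (Matrix.toLinearMap₂' ℝ : Matrix (Fin d) (Fin d) ℝ ≃ₗ[ℝ] (Fin d → ℝ) →ₗ[ℝ] (Fin d → ℝ) →ₗ[ℝ] ℝ).injective
  rw [map_smul, ← e₁, ← e₂]
  refine LinearMap.ext fun x => LinearMap.ext fun y => ?_
  simp only [LinearMap.smul_apply, smul_eq_mul]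
  rw [div_mul_eq_mul_div, eq_div_iff hq.ne']
  linarith [all x y]
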